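/- (Theorem 4, case m = n−2) Let n ≥ 2 and m = n − 2, let H(z) = Q_{nm}(z)/P_{nm}(z) be the (n, n−2) Padé approximant of e^{−s} viewed as a complex rational function, and let τ(ω) = −Re(H′(iω)/H(iω)) be its group delay. Then τ(0) = 1, the derivatives of τ at ω = 0 of every order 1, 2, …, 2n − 3 vanish, and the derivative of order 2n − 2 is nonzero; i.e., the delay approximation is maximally flat of order m + 1 = n − 1. -/

import Mathlib

open Polynomial Finset Nat

/-- Numerator polynomial `Q_{nm}` of the `(n,m)` Padé approximant of `e^{−s}`. -/
noncomputable def padeQ (n m : ℕ) : Polynomial ℝ :=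
  Polynomial.C ((n ! : ℝ) / ((n + m)! : ℝ)) *
    ∑ k ∈ Finset.range (m + 1),
      Polynomial.C ((m.choose k : ℝ) * (((n + k)! : ℝ) / (n ! : ℝ))) * (-Polynomial.X) ^ (m - k)

/-- Denominator polynomial `P_{nm}` of the `(n,m)` Padé approximant of `e^{−s}`. -/
noncomputable def padeP (n m : ℕ) : Polynomial ℝ :=
  Polynomial.C ((m ! : ℝ) / ((n + m)! : ℝ)) *
    ∑ k ∈ Finset.range (n + 1),
      Polynomial.C ((n.choose k : ℝ) * (((m + k)! : ℝ) / (m ! : ℝ))) * Polynomial.X ^ (n - k)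

/-- The `(n,m)` Padé approximant `H(z) = Q_{nm}(z)/P_{nm}(z)` as a complex rational function. -/
noncomputable def padeH (n m : ℕ) : ℂ → ℂ := fun z =>
  Polynomial.aeval z (padeQ n m) / Polynomial.aeval z (padeP n m)

/-- Group delay along the imaginary axis: `τ(ω) = −Re(H′(iω)/H(iω))`. -/
noncomputable def groupDelay (H : ℂ → ℂ) : ℝ → ℝ := fun ω =>
  -(deriv H ((ω : ℂ) * Complex.I) / H ((ω : ℂ) * Complex.I)).re

theorem coeff_padeP (n m j : ℕ) :
    (padeP n m).coeff j = n.choose j * (((n + m - j)! : ℝ) / ((n + m)! : ℝ)) := by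
  have hm : (m ! : ℝ) ≠ 0 := by positivity
  rw [padeP, coeff_C_mul, finsetSum_coeff]
  simp only [coeff_C_mul, coeff_X_pow]
  rcases le_or_gt j n with hj | hj
  · rw [Finset.sum_eq_single (n - j)]
    · have h1 : n - (n - j) = j := by omega
      have h2 : m + (n - j) = n + m - j := by omega
      rw [h1, h2, Nat.choose_symm hj]
      simp only [if_true]
      field_simp
    · intro k hk hkj
      rw [Finset.mem_range] at hk
      rw [if_neg (by omega), mul_zero]
    · intro h
      exact absurd (Finset.mem_range.2 (by omega)) h
  · rw [Nat.choose_eq_zero_of_lt hj, Finset.sum_eq_zero]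
    · simp
    · intro k _
      rw [if_neg (by omega), mul_zero]

theorem padeQ_eq_comp (n m : ℕ) : padeQ n m = (padeP m n).comp (-X) := by
  simp [padeQ, padeP, Polynomial.sum_comp, Nat.add_comm m n]

theorem natDegree_padeP_le (n m : ℕ) : (padeP n m).natDegree ≤ n := by
  refine natDegree_le_iff_coeff_eq_zero.2 ?_
  intro j hj
  rw [coeff_padeP, Nat.choose_eq_zero_of_lt hj]
  simp

theorem natDegree_padeQ_le (n m : ℕ) : (padeQ n m).natDegree ≤ m := by
  rw [padeQ_eq_comp]
  refine natDegree_comp_le.trans ?_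
  simpa using natDegree_padeP_le m n

theorem padeP_ode (n m : ℕ) :
    X * derivative (derivative (padeP n m)) =
      (C ((n + m : ℕ) : ℝ) + X) * derivative (padeP n m) - C (n : ℝ) * padeP n m := by
  have key (j : ℕ) : ((n : ℝ) - j) * (padeP n m).coeff j =
      (((n + m : ℕ) : ℝ) - j) * ((j + 1) * (padeP n m).coeff (j + 1)) := by
    rcases lt_trichotomy j n with hj | rfl | hj
    · have hc : ((n.choose (j + 1) : ℝ)) * (j + 1) = n.choose j * (n - j) := by
        have := Nat.choose_succ_right_eq n j
        rw [← Nat.cast_sub hj.le]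
        exact_mod_cast this
      have hf : ((n + m - j)! : ℝ) = (((n + m : ℕ) : ℝ) - j) * ((n + m - (j + 1))! : ℝ) := by
        obtain ⟨d, hd⟩ : ∃ d, n + m = j + 1 + d := ⟨n + m - (j + 1), by omega⟩
        have h1 : n + m - j = d + 1 := by omega
        have h2 : n + m - (j + 1) = d := by omega
        rw [h1, h2, hd, Nat.factorial_succ]
        push_cast
        ring
      rw [coeff_padeP, coeff_padeP, hf]
      linear_combination (-(((n + m : ℕ) : ℝ) - j) * ((n + m - (j + 1))! : ℝ) / ((n + m)! : ℝ)) * hc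
    · rw [coeff_padeP j m (j + 1), Nat.choose_succ_self]
      simp
    · rw [coeff_padeP, coeff_padeP, Nat.choose_eq_zero_of_lt hj,
        Nat.choose_eq_zero_of_lt (hj.trans j.lt_succ_self)]
      simp
  ext j
  rw [add_mul, coeff_sub, coeff_add, coeff_C_mul, coeff_C_mul]
  rcases j with - | j
  · have := key 0
    simp [coeff_derivative] at this ⊢
    linarith
  · have := key (j + 1)
    simp only [coeff_X_mul, coeff_derivative]
    push_cast at this ⊢
    linarith

theorem padeQ_ode (n m : ℕ) :
    X * derivative (derivative (padeQ n m)) =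
      (C ((n + m : ℕ) : ℝ) - X) * derivative (padeQ n m) + C (m : ℝ) * padeQ n m := by
  have h := congrArg (fun p : ℝ[X] => p.comp (-X)) (padeP_ode m n)
  rw [padeQ_eq_comp, derivative_comp, derivative_mul, derivative_comp, Nat.add_comm n m]
  simp only [mul_comp, sub_comp, add_comp, X_comp, C_comp, derivative_neg, derivative_X,
    derivative_one, neg_zero] at h ⊢
  linear_combination -h

/-- Cleared form of `H' / H = -1 + c z ^ (n + m) / (Q P)`. -/
theorem pade_wronskian (n m : ℕ) :
    ∃ c : ℝ, c ≠ 0 ∧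
      derivative (padeQ n m) * padeP n m - padeQ n m * derivative (padeP n m)
        + padeQ n m * padeP n m = C c * X ^ (n + m) := by
  set P := padeP n m with hP
  set Q := padeQ n m with hQ
  set W := derivative Q * P - Q * derivative P + Q * P with hW
  have hode : X * derivative W = C ((n + m : ℕ) : ℝ) * W := by
    have h1 := padeP_ode n m
    have h2 := padeQ_ode n m
    rw [← hP] at h1
    rw [← hQ] at h2
    have h3 : (C ((n + m : ℕ) : ℝ) : ℝ[X]) = C (n : ℝ) + C (m : ℝ) := by simp
    simp only [hW, derivative_add, derivative_sub, derivative_mul]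
    linear_combination P * h2 - Q * h1 - Q * P * h3
  have hcoeff (j : ℕ) (hj : j ≠ n + m) : W.coeff j = 0 := by
    have h := congrArg (fun p : ℝ[X] => p.coeff j) hode
    have hj' : (j : ℝ) - ((n + m : ℕ) : ℝ) ≠ 0 := sub_ne_zero.2 (by exact_mod_cast hj)
    refine (mul_eq_zero.1 (?_ : ((j : ℝ) - ((n + m : ℕ) : ℝ)) * W.coeff j = 0)).resolve_left hj'
    rcases j with - | j
    · simp only [coeff_C_mul, coeff_X_mul_zero] at h
      push_cast at h ⊢
      linarith
    · simp only [coeff_C_mul, coeff_X_mul, coeff_derivative] at h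
      push_cast at h ⊢
      linarith
  refine ⟨W.coeff (n + m), ?_, ?_⟩
  · have hPd : P.natDegree ≤ n := natDegree_padeP_le n m
    have hQd : Q.natDegree ≤ m := natDegree_padeQ_le n m
    have hlow (A B : ℝ[X]) (a b : ℕ) (hA : A.natDegree ≤ a) (hB : B.natDegree ≤ b)
        (hab : a + b = n + m) : (derivative A * B).coeff (n + m) = 0 := by
      rcases Nat.eq_zero_or_pos A.natDegree with h0 | h0
      · rw [derivative_of_natDegree_zero h0, zero_mul, coeff_zero]
      · refine coeff_eq_zero_of_natDegree_lt (natDegree_mul_le.trans_lt ?_)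
        have := natDegree_derivative_lt h0.ne'
        omega
    have hQP : (Q * P).coeff (n + m) = Q.coeff m * P.coeff n := by
      rw [Nat.add_comm]
      exact coeff_mul_add_eq_of_natDegree_le hQd hPd
    rw [hW, coeff_add, coeff_sub, mul_comm Q (derivative P), hlow Q P m n hQd hPd (Nat.add_comm _ _),
      hlow P Q n m hPd hQd rfl, hQP, sub_zero, zero_add, hQ, padeQ_eq_comp,
      ← neg_one_mul (X : ℝ[X]), ← C_1, ← C_neg, comp_C_mul_X_coeff, hP, coeff_padeP, coeff_padeP]
    simp only [Nat.choose_self]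
    have h1 : ((-1 : ℝ)) ^ m ≠ 0 := pow_ne_zero _ (by norm_num)
    positivity
  · ext j
    rw [coeff_C_mul, coeff_X_pow]
    split_ifs with h
    · rw [h, mul_one]
    · rw [hcoeff j h, mul_zero]

theorem deriv_padeH_div (n m : ℕ) {c : ℝ} {z : ℂ}
    (hc : derivative (padeQ n m) * padeP n m - padeQ n m * derivative (padeP n m)
        + padeQ n m * padeP n m = C c * X ^ (n + m))
    (hP : aeval z (padeP n m) ≠ 0) (hQ : aeval z (padeQ n m) ≠ 0) :
    deriv (padeH n m) z / padeH n m z =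
      -1 + c * z ^ (n + m) * (aeval z (padeQ n m * padeP n m))⁻¹ := by
  have hd : deriv (padeH n m) z =
      (aeval z (derivative (padeQ n m)) * aeval z (padeP n m) -
        aeval z (padeQ n m) * aeval z (derivative (padeP n m))) / aeval z (padeP n m) ^ 2 :=
    (((padeQ n m).hasDerivAt_aeval z).div ((padeP n m).hasDerivAt_aeval z) hP).deriv
  have h := congrArg (aeval z) hc
  simp only [map_add, map_sub, map_mul, map_pow, aeval_X, aeval_C, Complex.coe_algebraMap] at h
  rw [hd, padeH, map_mul, ← h]
  field_simp
  ring

theorem iteratedDeriv_pow_mul_zero {g : ℝ → ℝ} {k N : ℕ} (hg : ContDiffAt ℝ k g 0)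
    (hk : k ≤ N) :
    iteratedDeriv k (fun x => x ^ N * g x) 0 = if k = N then N ! * g 0 else 0 := by
  rw [iteratedDeriv_fun_mul (by fun_prop) hg]
  simp only [iteratedDeriv_fun_pow_zero]
  split_ifs with h
  · subst h
    rw [Finset.sum_eq_single k]
    · simp
    · intro i _ hik
      simp [hik]
    · simp
  · refine Finset.sum_eq_zero fun i hi => ?_
    rw [Finset.mem_range] at hi
    rw [if_neg (by omega)]
    simp

theorem groupDelay_padeH_eventuallyEq (n m l : ℕ) (hl : n + m = 2 * l) :
    ∃ (a : ℝ) (g : ℝ → ℝ), a ≠ 0 ∧ g 0 ≠ 0 ∧ (∀ k : ℕ, ContDiffAt ℝ k g 0) ∧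
      groupDelay (padeH n m) =ᶠ[nhds 0] fun ω => 1 + a * (ω ^ (n + m) * g ω) := by
  obtain ⟨c, hc0, hc⟩ := pade_wronskian n m
  have hP0 : (padeP n m).coeff 0 = 1 := by
    rw [coeff_padeP]
    simp [Nat.factorial_ne_zero]
  have hQ0 : (padeQ n m).coeff 0 = 1 := by
    rw [padeQ_eq_comp, ← neg_one_mul (X : ℝ[X]), ← C_1, ← C_neg, comp_C_mul_X_coeff, coeff_padeP]
    simp [Nat.factorial_ne_zero]
  have hcd (p : ℝ[X]) (k : ℕ) : ContDiff ℝ k fun ω : ℝ => aeval ((ω : ℂ) * Complex.I) p := by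
    have h1 : ContDiff ℝ k fun ω : ℝ => (ω : ℂ) * Complex.I :=
      Complex.ofRealCLM.contDiff.mul contDiff_const
    exact ((p.contDiff_aeval (𝕜 := ℂ) k).restrict_scalars ℝ).comp h1
  have hne (p : ℝ[X]) (hp : p.coeff 0 = 1) :
      ∀ᶠ ω : ℝ in nhds 0, aeval ((ω : ℂ) * Complex.I) p ≠ 0 := by
    refine (hcd p 0).continuous.continuousAt.eventually_ne ?_
    simp [← coeff_zero_eq_aeval_zero', hp]
  refine ⟨-(c * (-1) ^ l),
    fun ω => ((aeval ((ω : ℂ) * Complex.I) (padeQ n m * padeP n m))⁻¹).re, ?_, ?_, fun k => ?_, ?_⟩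
  · exact neg_ne_zero.2 (mul_ne_zero hc0 (pow_ne_zero _ (by norm_num)))
  · simp [← coeff_zero_eq_aeval_zero', hP0, hQ0]
  · refine Complex.reCLM.contDiff.contDiffAt.comp (0 : ℝ) ((hcd _ k).contDiffAt.inv ?_)
    simp [← coeff_zero_eq_aeval_zero', hP0, hQ0]
  · filter_upwards [hne _ hP0, hne _ hQ0] with ω hPω hQω
    have hpow : (c : ℂ) * ((ω : ℂ) * Complex.I) ^ (n + m) =
        ((c * (-1) ^ l * ω ^ (n + m) : ℝ) : ℂ) := by
      rw [mul_pow, hl, pow_mul Complex.I, Complex.I_sq]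
      push_cast
      ring
    rw [groupDelay, deriv_padeH_div n m hc hPω hQω, hpow, Complex.add_re, Complex.re_ofReal_mul]
    simp only [Complex.neg_re, Complex.one_re]
    ring

/-- Theorem 4, case `m = n−2`: the group delay `τ` of the `(n, n−2)` Padé
approximant satisfies `τ(0) = 1`, its derivatives of orders `1, …, 2n−3` vanish at `0`, and
its derivative of order `2n−2` is nonzero: the delay approximation is maximally flat of
order `m + 1 = n − 1`. -/
theorem pade_delay_flat_nm2 (n : ℕ) (hn : 2 ≤ n) :
    groupDelay (padeH n (n - 2)) 0 = 1 ∧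
    (∀ k : ℕ, 1 ≤ k → k ≤ 2 * n - 3 → iteratedDeriv k (groupDelay (padeH n (n - 2))) 0 = 0) ∧
    iteratedDeriv (2 * n - 2) (groupDelay (padeH n (n - 2))) 0 ≠ 0 := by
  obtain ⟨a, g, ha, hg0, hg, heq⟩ :=
    groupDelay_padeH_eventuallyEq n (n - 2) (n - 1) (by omega)
  have hN : n + (n - 2) = 2 * n - 2 := by omega
  rw [hN] at heq
  have hderiv (k : ℕ) (hk : 1 ≤ k) (hkN : k ≤ 2 * n - 2) :
      iteratedDeriv k (groupDelay (padeH n (n - 2))) 0 =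
        a * if k = 2 * n - 2 then (2 * n - 2)! * g 0 else 0 := by
    rw [heq.iteratedDeriv_eq k, iteratedDeriv_const_add hk, iteratedDeriv_const_mul_field,
      iteratedDeriv_pow_mul_zero (hg k) hkN]
  refine ⟨?_, fun k hk hkN => ?_, ?_⟩
  · rw [heq.eq_of_nhds, zero_pow (by omega)]
    ring
  · rw [hderiv k hk (by omega), if_neg (by omega), mul_zero]
  · rw [hderiv _ (by omega) le_rfl, if_pos rfl]
    exact mul_ne_zero ha (mul_ne_zero (by positivity) hg0)
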